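/- arXiv:2107.07827 — 3 statements merged into one kernel-verified Lean document; each statement's English description precedes it below -/
import Mathlib

section
/- Let f : ℤ → ℕ be finitely supported, k ≥ 1 and h ≥ 1 integers. Then x ∈ ℤ satisfies (γₖ f)(x) ≥ h if and only if x belongs to a run of the level set S_h(f) of cardinality at least k. Equivalently, the level set S_h(γₖ f) is the union of those runs of S_h(f) whose cardinality is at least k. -/
namespace Granulo

/-- Opening of a one-dimensional DEM `f` by a segment of length `k` (closed form):
`(γₖ f)(x) = max{ min{ f(y) : a ≤ y ≤ a+k−1 } : a ≤ x ≤ a+k−1 }`. -/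
noncomputable def opening (k : ℕ) (f : ℤ → ℕ) (x : ℤ) : ℕ :=
  sSup {m : ℕ | ∃ a : ℤ, a ≤ x ∧ x ≤ a + (k : ℤ) - 1 ∧
    m = sInf {n : ℕ | ∃ y : ℤ, a ≤ y ∧ y ≤ a + (k : ℤ) - 1 ∧ n = f y}}

/-- Volume of a one-dimensional DEM. -/
noncomputable def vol (f : ℤ → ℕ) : ℕ := ∑ᶠ x : ℤ, f x

/-- Level set `S_h(f) = {x : f x ≥ h}`. -/
def levelSet (h : ℕ) (f : ℤ → ℕ) : Set ℤ := {x : ℤ | h ≤ f x}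

/-- A set of consecutive integers. -/
def IsInterval (R : Set ℤ) : Prop :=
  ∀ a ∈ R, ∀ b ∈ R, ∀ c : ℤ, a ≤ c → c ≤ b → c ∈ R

/-- `R` is a run of `S`: a maximal nonempty set of consecutive integers contained in `S`. -/
def IsRun (S R : Set ℤ) : Prop :=
  R.Nonempty ∧ R ⊆ S ∧ IsInterval R ∧
    ∀ R' : Set ℤ, R ⊆ R' → R' ⊆ S → IsInterval R' → R' = R

/-- `n_{t,h}(f)`: number of runs of `S_h(f)` of cardinality `t`. -/
noncomputable def runCount (f : ℤ → ℕ) (t h : ℕ) : ℕ :=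
  {R : Set ℤ | IsRun (levelSet h f) R ∧ R.ncard = t}.ncard

/-- Granulometric probability `p_k(f) = (V(γₖ f) − V(γ_{k+1} f))/V(f)`. -/
noncomputable def p (k : ℕ) (f : ℤ → ℕ) : ℝ :=
  ((vol (opening k f) : ℝ) - (vol (opening (k+1) f) : ℝ)) / (vol f : ℝ)

/-- Granulometric index `GI(f) = −Σ_{k≥1} p_k log p_k` (terms with `p_k = 0` are `0`). -/
noncomputable def gi (f : ℤ → ℕ) : ℝ :=
  -∑ᶠ k ∈ Set.Ici (1 : ℕ), p k f * Real.log (p k f)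

/-- Volume of a two-dimensional DEM. -/
noncomputable def vol2 (f : ℤ × ℤ → ℕ) : ℕ := ∑ᶠ q : ℤ × ℤ, f q

/-- Horizontal opening: apply `γₖ` to each row `i ↦ f (i, ·)`. -/
noncomputable def hOpening (k : ℕ) (f : ℤ × ℤ → ℕ) : ℤ × ℤ → ℕ :=
  fun q => opening k (fun j => f (q.1, j)) q.2

/-- Row-wise run count `n_{t,h}^{(i)}(f)`. -/
noncomputable def rowRunCount (f : ℤ × ℤ → ℕ) (i : ℤ) (t h : ℕ) : ℕ :=
  runCount (fun j => f (i, j)) t h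

/-- Granulometric probability w.r.t. horizontal openings. -/
noncomputable def p2 (k : ℕ) (f : ℤ × ℤ → ℕ) : ℝ :=
  ((vol2 (hOpening k f) : ℝ) - (vol2 (hOpening (k+1) f) : ℝ)) / (vol2 f : ℝ)

/-- Granulometric index w.r.t. horizontal openings. -/
noncomputable def gi2 (f : ℤ × ℤ → ℕ) : ℝ :=
  -∑ᶠ k ∈ Set.Ici (1 : ℕ), p2 k f * Real.log (p2 k f)


/-- The values of `f` on a window of length `k ≥ 1` form a nonempty set. -/
theorem window_inf_nonempty (f : ℤ → ℕ) {k : ℕ} (hk : 1 ≤ k) (a : ℤ) :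
    {n : ℕ | ∃ y : ℤ, a ≤ y ∧ y ≤ a + (k : ℤ) - 1 ∧ n = f y}.Nonempty :=
  ⟨f a, a, le_rfl, by omega, rfl⟩

theorem le_window_inf_iff (f : ℤ → ℕ) {k : ℕ} (hk : 1 ≤ k) (h : ℕ) (a : ℤ) :
    h ≤ sInf {n : ℕ | ∃ y : ℤ, a ≤ y ∧ y ≤ a + (k : ℤ) - 1 ∧ n = f y} ↔
      Set.Icc a (a + (k : ℤ) - 1) ⊆ levelSet h f := by
  rw [le_csInf_iff (OrderBot.bddBelow _) (window_inf_nonempty f hk a)]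
  constructor
  · intro H y hy
    exact H _ ⟨y, hy.1, hy.2, rfl⟩
  · rintro H _ ⟨y, h₁, h₂, rfl⟩
    exact H ⟨h₁, h₂⟩

theorem le_opening_iff (f : ℤ → ℕ) {k : ℕ} (hk : 1 ≤ k) (h : ℕ) (x : ℤ) :
    h ≤ opening k f x ↔
      ∃ a : ℤ, a ≤ x ∧ x ≤ a + (k : ℤ) - 1 ∧
        Set.Icc a (a + (k : ℤ) - 1) ⊆ levelSet h f := by
  set M := {m : ℕ | ∃ a : ℤ, a ≤ x ∧ x ≤ a + (k : ℤ) - 1 ∧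
    m = sInf {n : ℕ | ∃ y : ℤ, a ≤ y ∧ y ≤ a + (k : ℤ) - 1 ∧ n = f y}}
  have hne : M.Nonempty := ⟨_, x, le_rfl, by omega, rfl⟩
  have hbdd : BddAbove M := by
    refine ⟨f x, ?_⟩
    rintro _ ⟨a, h₁, h₂, rfl⟩
    exact Nat.sInf_le ⟨x, h₁, h₂, rfl⟩
  constructor
  · intro H
    obtain ⟨a, h₁, h₂, h₃⟩ := Nat.sSup_mem hne hbdd
    refine ⟨a, h₁, h₂, (le_window_inf_iff f hk h a).1 ?_⟩
    rw [← h₃]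
    exact H
  · rintro ⟨a, h₁, h₂, h₃⟩
    exact ((le_window_inf_iff f hk h a).2 h₃).trans (le_csSup hbdd ⟨a, h₁, h₂, rfl⟩)

/-- The run of `S` through one of its points. -/
theorem isRun_setOf_uIcc_subset {S : Set ℤ} {x : ℤ} (hx : x ∈ S) :
    IsRun S {y | Set.uIcc x y ⊆ S} := by
  refine ⟨⟨x, by simpa using hx⟩, fun y hy => hy Set.right_mem_uIcc, ?_, ?_⟩
  · intro a ha b hb c hac hcb z hz
    by_cases hza : z ∈ Set.uIcc x a
    · exact ha hza
    · apply hb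
      simp only [Set.mem_uIcc] at *
      omega
  · intro R' hR hS hI
    refine Set.Subset.antisymm (fun y hy z hz => hS ?_) hR
    have hxR : x ∈ R' := hR (by simpa using hx)
    rcases Set.mem_uIcc.1 hz with hz | hz
    · exact hI x hxR y hy z hz.1 hz.2
    · exact hI y hy x hxR z hz.1 hz.2

theorem levelSet_finite {f : ℤ → ℕ} (hf : (Function.support f).Finite) {h : ℕ}
    (hh : 1 ≤ h) : (levelSet h f).Finite :=
  hf.subset fun x (hx : h ≤ f x) => by
    rw [Function.mem_support]
    omega

theorem IsInterval.exists_eq_Icc {R : Set ℤ} (hI : IsInterval R) (hR : R.Finite)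
    (hne : R.Nonempty) : ∃ a b : ℤ, R = Set.Icc a b := by
  obtain ⟨a, ha, hmin⟩ := hR.exists_minimal hne
  obtain ⟨b, hb, hmax⟩ := hR.exists_maximal hne
  refine ⟨a, b, Set.Subset.antisymm (fun y hy => ⟨?_, ?_⟩) fun y hy => hI a ha b hb y hy.1 hy.2⟩
  · exact (le_total a y).elim id (hmin hy)
  · exact (le_total y b).elim id (hmax hy)

theorem ncard_Icc_int (a b : ℤ) : (Set.Icc a b).ncard = (b + 1 - a).toNat := by
  rw [← Finset.coe_Icc, Set.ncard_coe_finset, Int.card_Icc]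

theorem le_opening_iff_exists_isRun {f : ℤ → ℕ} (hf : (Function.support f).Finite)
    {k : ℕ} (hk : 1 ≤ k) {h : ℕ} (hh : 1 ≤ h) (x : ℤ) :
    h ≤ opening k f x ↔
      ∃ R : Set ℤ, IsRun (levelSet h f) R ∧ x ∈ R ∧ k ≤ R.ncard := by
  have hfin := levelSet_finite hf hh
  rw [le_opening_iff f hk]
  constructor
  · rintro ⟨a, h₁, h₂, hsub⟩
    have hx : x ∈ levelSet h f := hsub ⟨h₁, h₂⟩
    have hrun := isRun_setOf_uIcc_subset hx
    refine ⟨_, hrun, by simpa using hx, ?_⟩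
    have hle : Set.Icc a (a + (k : ℤ) - 1) ⊆ {y | Set.uIcc x y ⊆ levelSet h f} :=
      fun y hy => (Set.uIcc_subset_Icc ⟨h₁, h₂⟩ hy).trans hsub
    have hcard := Set.ncard_le_ncard hle (hfin.subset hrun.2.1)
    rw [ncard_Icc_int] at hcard
    omega
  · rintro ⟨R, ⟨hne, hsub, hI, -⟩, hx, hcard⟩
    obtain ⟨a, b, rfl⟩ := hI.exists_eq_Icc (hfin.subset hsub) hne
    rw [ncard_Icc_int] at hcard
    obtain ⟨hax, hxb⟩ := hx
    refine ⟨min x (b - k + 1), by omega, by omega, fun y hy => hsub ⟨?_, ?_⟩⟩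
    · have := hy.1
      omega
    · have := hy.2
      omega

/-- `(γₖ f)(x) ≥ h` iff `x` lies in a run of `S_h(f)` of cardinality at
least `k`; equivalently `S_h(γₖ f)` is the union of the runs of `S_h(f)` of
cardinality at least `k`. -/
theorem levelSet_opening_eq_union_long_runs (f : ℤ → ℕ)
    (hf : (Function.support f).Finite) (k : ℕ) (hk : 1 ≤ k) (h : ℕ) (hh : 1 ≤ h) :
    (∀ x : ℤ, h ≤ opening k f x ↔
      ∃ R : Set ℤ, IsRun (levelSet h f) R ∧ x ∈ R ∧ k ≤ R.ncard) ∧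
    levelSet h (opening k f) = ⋃₀ {R : Set ℤ | IsRun (levelSet h f) R ∧ k ≤ R.ncard} := by
  refine ⟨le_opening_iff_exists_isRun hf hk hh, Set.ext fun x => ?_⟩
  refine (le_opening_iff_exists_isRun hf hk hh x).trans ?_
  simp only [Set.mem_sUnion, Set.mem_ofPred_eq, and_assoc, and_comm (a := x ∈ _)]

end Granulo
end

section
/- (Main invariance theorem.) Let f₁, f₂ : ℤ² → ℕ be finitely supported with V(f₁) > 0, and suppose that for every row index i, every cardinality t ≥ 1 and every elevation h ≥ 1, the row-wise run counts agree: n_{t,h}^{(i)}(f₁) = n_{t,h}^{(i)}(f₂). Then the granulometric indices with respect to horizontal openings are equal: GI(f₁) = GI(f₂). -/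
namespace Granulo

theorem isRun_ordConnectedComponent {S : Set ℤ} {x : ℤ} (hx : x ∈ S) :
    IsRun S (S.ordConnectedComponent x) := by
  refine ⟨⟨x, Set.self_mem_ordConnectedComponent.2 hx⟩, Set.ordConnectedComponent_subset, ?_, ?_⟩
  · intro a ha b hb c hac hcb
    exact (inferInstance : (S.ordConnectedComponent x).OrdConnected).out ha hb ⟨hac, hcb⟩
  · intro R' hR hS hI
    refine Set.Subset.antisymm (fun y hy => ?_) hR
    have hxR : x ∈ R' := hR (Set.self_mem_ordConnectedComponent.2 hx)
    intro z hz
    apply hS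
    rcases Set.mem_uIcc.1 hz with h | h
    · exact hI x hxR y hy z h.1 h.2
    · exact hI y hy x hxR z h.1 h.2

theorem IsRun.eq_ordConnectedComponent {S R : Set ℤ} (hR : IsRun S R) {x : ℤ} (hx : x ∈ R) :
    R = S.ordConnectedComponent x := by
  obtain ⟨-, hS, hI, hmax⟩ := hR
  have hrun := isRun_ordConnectedComponent (hS hx)
  refine (hmax _ (fun y hy => ?_) hrun.2.1 hrun.2.2.1).symm
  intro z hz
  apply hS
  rcases Set.mem_uIcc.1 hz with h | h
  · exact hI x hx y hy z h.1 h.2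
  · exact hI y hy x hx z h.1 h.2

theorem IsRun.eq_Icc {S R : Set ℤ} (hS : S.Finite) (hR : IsRun S R) :
    ∃ m M : ℤ, R = Set.Icc m M := by
  have hfin : R.Finite := hS.subset hR.2.1
  obtain ⟨m, hm, hmin⟩ := Set.exists_min_image R id hfin hR.1
  obtain ⟨M, hM, hmax⟩ := Set.exists_max_image R id hfin hR.1
  exact ⟨m, M, Set.Subset.antisymm (fun y hy => ⟨hmin y hy, hmax y hy⟩)
    (fun y hy => hR.2.2.1 m hm M hM y hy.1 hy.2)⟩

/-- A point lies in a window of length `k` inside `S` iff it lies in a run of cardinality at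
least `k`. -/
theorem exists_window_iff_exists_isRun {S : Set ℤ} (hS : S.Finite) {k : ℕ} {x : ℤ}
    (hk : 1 ≤ k) :
    (∃ a : ℤ, a ≤ x ∧ x ≤ a + (k : ℤ) - 1 ∧ Set.Icc a (a + (k : ℤ) - 1) ⊆ S) ↔
      ∃ R, IsRun S R ∧ k ≤ R.ncard ∧ x ∈ R := by
  constructor
  · rintro ⟨a, hax, hxa, hsub⟩
    have hx : x ∈ S := hsub ⟨hax, hxa⟩
    refine ⟨_, isRun_ordConnectedComponent hx, ?_, Set.self_mem_ordConnectedComponent.2 hx⟩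
    have hle : Set.Icc a (a + (k : ℤ) - 1) ⊆ S.ordConnectedComponent x :=
      fun y hy => (Set.ordConnected_Icc.uIcc_subset ⟨hax, hxa⟩ hy).trans hsub
    have hcard := Set.ncard_le_ncard hle (hS.subset Set.ordConnectedComponent_subset)
    rw [ncard_Icc_int] at hcard
    omega
  · rintro ⟨R, hR, hcard, hx⟩
    have hRS := hR.2.1
    obtain ⟨m, M, rfl⟩ := hR.eq_Icc hS
    rw [ncard_Icc_int] at hcard
    obtain ⟨hmx, hxM⟩ := hx
    refine ⟨max m (x - k + 1), by omega, by omega, fun y hy => hRS ?_⟩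
    obtain ⟨h1, h2⟩ := hy
    constructor <;> omega

theorem le_opening_iff_exists_window {g : ℤ → ℕ} {k h : ℕ} (hk : 1 ≤ k) (x : ℤ) :
    h ≤ opening k g x ↔
      ∃ a : ℤ, a ≤ x ∧ x ≤ a + (k : ℤ) - 1 ∧
        Set.Icc a (a + (k : ℤ) - 1) ⊆ levelSet h g := by
  have hsInf : ∀ a : ℤ, a ≤ x → x ≤ a + (k : ℤ) - 1 →
      (h ≤ sInf {n : ℕ | ∃ y : ℤ, a ≤ y ∧ y ≤ a + (k : ℤ) - 1 ∧ n = g y} ↔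
        Set.Icc a (a + (k : ℤ) - 1) ⊆ levelSet h g) := by
    intro a h1 h2
    constructor
    · exact fun H y hy => H.trans (Nat.sInf_le ⟨y, hy.1, hy.2, rfl⟩)
    · refine fun H => le_csInf ⟨g x, x, h1, h2, rfl⟩ ?_
      rintro _ ⟨y, hy1, hy2, rfl⟩
      exact H ⟨hy1, hy2⟩
  have hmem : ∀ a : ℤ, a ≤ x → x ≤ a + (k : ℤ) - 1 →
      sInf {n : ℕ | ∃ y : ℤ, a ≤ y ∧ y ≤ a + (k : ℤ) - 1 ∧ n = g y} ∈
        {m : ℕ | ∃ a : ℤ, a ≤ x ∧ x ≤ a + (k : ℤ) - 1 ∧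
          m = sInf {n : ℕ | ∃ y : ℤ, a ≤ y ∧ y ≤ a + (k : ℤ) - 1 ∧ n = g y}} :=
    fun a h1 h2 => ⟨a, h1, h2, rfl⟩
  have hbdd : BddAbove {m : ℕ | ∃ a : ℤ, a ≤ x ∧ x ≤ a + (k : ℤ) - 1 ∧
      m = sInf {n : ℕ | ∃ y : ℤ, a ≤ y ∧ y ≤ a + (k : ℤ) - 1 ∧ n = g y}} := by
    refine ⟨g x, ?_⟩
    rintro _ ⟨a, h1, h2, rfl⟩
    exact Nat.sInf_le ⟨x, h1, h2, rfl⟩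
  constructor
  · intro H
    obtain ⟨a, h1, h2, h3⟩ := Nat.sSup_mem (Set.nonempty_of_mem (hmem x le_rfl (by omega))) hbdd
    exact ⟨a, h1, h2, (hsInf a h1 h2).1 (h3 ▸ H)⟩
  · rintro ⟨a, h1, h2, h3⟩
    exact ((hsInf a h1 h2).2 h3).trans (le_csSup hbdd (hmem a h1 h2))

theorem opening_le {g : ℤ → ℕ} {k : ℕ} (hk : 1 ≤ k) (x : ℤ) : opening k g x ≤ g x := by
  obtain ⟨a, h1, h2, h3⟩ := (le_opening_iff_exists_window (g := g) hk x).1 le_rfl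
  exact h3 ⟨h1, h2⟩

theorem opening_one (g : ℤ → ℕ) : opening 1 g = g := by
  funext x
  refine (opening_le le_rfl x).antisymm
    ((le_opening_iff_exists_window le_rfl x).2 ⟨x, le_rfl, by simp, fun y hy => ?_⟩)
  obtain rfl : y = x := by have := hy.1; have := hy.2; push_cast at *; omega
  exact le_refl (g y)

theorem levelSet_opening {g : ℤ → ℕ} {k h : ℕ} (hk : 1 ≤ k) (hfin : (levelSet h g).Finite) :
    levelSet h (opening k g) = ⋃₀ {R | IsRun (levelSet h g) R ∧ k ≤ R.ncard} := by
  ext x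
  refine (le_opening_iff_exists_window hk x).trans
    ((exists_window_iff_exists_isRun hfin hk).trans ?_)
  simp [and_assoc]

theorem finite_levelSet {g : ℤ → ℕ} (hg : g.support.Finite) {h : ℕ} (hh : 1 ≤ h) :
    (levelSet h g).Finite :=
  hg.subset fun _ hx => (Nat.lt_of_lt_of_le hh hx).ne'

theorem ncard_sUnion_isRun {S : Set ℤ} (hS : S.Finite) (k N : ℕ) (hN : S.ncard ≤ N) :
    (⋃₀ {R | IsRun S R ∧ k ≤ R.ncard}).ncard =
      ∑ t ∈ Finset.Icc k N, t * {R | IsRun S R ∧ R.ncard = t}.ncard := by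
  have hruns : {R | IsRun S R ∧ k ≤ R.ncard}.Finite :=
    hS.finite_subsets.subset fun R hR => hR.1.2.1
  have hunion : ⋃₀ {R | IsRun S R ∧ k ≤ R.ncard} = ⋃ R ∈ {R | IsRun S R ∧ k ≤ R.ncard}, R :=
    Set.sUnion_eq_biUnion
  have hdisj : {R | IsRun S R ∧ k ≤ R.ncard}.PairwiseDisjoint id := by
    intro R hR R' hR' hne
    refine Set.disjoint_left.2 fun x hx hx' => hne ?_
    exact (hR.1.eq_ordConnectedComponent hx).trans (hR'.1.eq_ordConnectedComponent hx').symm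
  have hcard : (⋃₀ {R | IsRun S R ∧ k ≤ R.ncard}).ncard = ∑ R ∈ hruns.toFinset, R.ncard := by
    rw [hunion, hruns.ncard_biUnion (fun R hR => hS.subset hR.1.2.1) hdisj,
      finsum_mem_eq_finite_toFinset_sum _ hruns]
  rw [hcard, ← Finset.sum_fiberwise_of_maps_to (g := Set.ncard) (t := Finset.Icc k N)]
  · refine Finset.sum_congr rfl fun t ht => ?_
    rw [Finset.sum_congr rfl (g := fun _ => t) (fun R hR => (Finset.mem_filter.1 hR).2),
      Finset.sum_const, smul_eq_mul, mul_comm, ← Set.ncard_coe_finset]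
    congr 2
    ext R
    have := (Finset.mem_Icc.1 ht).1
    simp only [Finset.coe_filter, Set.Finite.mem_toFinset, Set.mem_ofPred_eq]
    constructor
    · exact fun H => ⟨H.1.1, H.2⟩
    · exact fun H => ⟨⟨H.1, H.2 ▸ this⟩, H.2⟩
  · intro R hR
    rw [Set.Finite.mem_toFinset] at hR
    exact Finset.mem_Icc.2 ⟨hR.2, (Set.ncard_le_ncard hR.1.2.1 hS).trans hN⟩

theorem ncard_levelSet_opening_congr {g₁ g₂ : ℤ → ℕ} (hg₁ : g₁.support.Finite)
    (hg₂ : g₂.support.Finite) {k h : ℕ} (hk : 1 ≤ k) (hh : 1 ≤ h)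
    (hrun : ∀ t, 1 ≤ t → runCount g₁ t h = runCount g₂ t h) :
    (levelSet h (opening k g₁)).ncard = (levelSet h (opening k g₂)).ncard := by
  have h₁ := finite_levelSet hg₁ hh
  have h₂ := finite_levelSet hg₂ hh
  rw [levelSet_opening hk h₁, levelSet_opening hk h₂,
    ncard_sUnion_isRun h₁ k _ (le_max_left _ (levelSet h g₂).ncard),
    ncard_sUnion_isRun h₂ k _ (le_max_right (levelSet h g₁).ncard _)]
  refine Finset.sum_congr rfl fun t ht => ?_
  exact congrArg (t * ·) (hrun t (hk.trans (Finset.mem_Icc.1 ht).1))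

/-- Layer-cake formula for the volume of a one-dimensional DEM. -/
theorem vol_eq_sum_ncard_levelSet {g : ℤ → ℕ} (hg : g.support.Finite) {M : ℕ}
    (hM : ∀ x, g x ≤ M) : vol g = ∑ h ∈ Finset.Icc 1 M, (levelSet h g).ncard := by
  have hlayer : ∀ x, g x = ∑ h ∈ Finset.Icc 1 M, if h ≤ g x then 1 else 0 := by
    intro x
    have : {h ∈ Finset.Icc 1 M | h ≤ g x} = Finset.Icc 1 (g x) := by
      ext h
      have := hM x
      simp only [Finset.mem_filter, Finset.mem_Icc]
      omega
    rw [← Finset.card_filter, this, Nat.card_Icc, Nat.add_sub_cancel]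
  rw [vol, finsum_eq_sum g hg, Finset.sum_congr rfl fun x _ => hlayer x, Finset.sum_comm]
  refine Finset.sum_congr rfl fun h hh => ?_
  rw [← Finset.card_filter, ← Set.ncard_coe_finset]
  congr 1
  ext x
  have := (Finset.mem_Icc.1 hh).1
  simp only [Finset.coe_filter, Set.Finite.mem_toFinset, Function.mem_support, Set.mem_ofPred_eq,
    levelSet]
  omega

theorem vol_congr {g₁ g₂ : ℤ → ℕ} (hg₁ : g₁.support.Finite) (hg₂ : g₂.support.Finite)
    (h : ∀ h, 1 ≤ h → (levelSet h g₁).ncard = (levelSet h g₂).ncard) : vol g₁ = vol g₂ := by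
  have hbdd : ∀ g : ℤ → ℕ, g.support.Finite → ∃ M, ∀ x, g x ≤ M := fun g hg => by
    obtain ⟨M, hM⟩ := (hg.image g).bddAbove
    refine ⟨M, fun x => ?_⟩
    by_cases hx : g x = 0
    · exact hx ▸ Nat.zero_le M
    · exact hM ⟨x, hx, rfl⟩
  obtain ⟨M₁, hM₁⟩ := hbdd g₁ hg₁
  obtain ⟨M₂, hM₂⟩ := hbdd g₂ hg₂
  rw [vol_eq_sum_ncard_levelSet hg₁ fun x => (hM₁ x).trans (le_max_left M₁ M₂),
    vol_eq_sum_ncard_levelSet hg₂ fun x => (hM₂ x).trans (le_max_right M₁ M₂)]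
  exact Finset.sum_congr rfl fun i hi => h i (Finset.mem_Icc.1 hi).1

theorem finite_support_opening {g : ℤ → ℕ} (hg : g.support.Finite) {k : ℕ} (hk : 1 ≤ k) :
    (opening k g).support.Finite :=
  hg.subset fun x hx => ((Nat.pos_of_ne_zero hx).trans_le (opening_le hk x)).ne'

theorem finite_support_row {f : ℤ × ℤ → ℕ} (hf : f.support.Finite) (i : ℤ) :
    (Function.support fun j => f (i, j)).Finite :=
  (hf.image Prod.snd).subset fun j hj => ⟨(i, j), hj, rfl⟩

theorem vol2_eq_finsum_vol {f : ℤ × ℤ → ℕ} (hf : f.support.Finite) :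
    vol2 f = ∑ᶠ i : ℤ, vol fun j => f (i, j) :=
  finsum_curry f hf

theorem finite_support_hOpening {f : ℤ × ℤ → ℕ} (hf : f.support.Finite) {k : ℕ} (hk : 1 ≤ k) :
    (hOpening k f).support.Finite :=
  hf.subset fun q hq =>
    ((Nat.pos_of_ne_zero hq).trans_le (opening_le (g := fun j => f (q.1, j)) hk q.2)).ne'

theorem vol2_hOpening_congr {f₁ f₂ : ℤ × ℤ → ℕ} (hf₁ : f₁.support.Finite)
    (hf₂ : f₂.support.Finite)
    (hrun : ∀ i : ℤ, ∀ t h : ℕ, 1 ≤ t → 1 ≤ h → rowRunCount f₁ i t h = rowRunCount f₂ i t h)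
    {k : ℕ} (hk : 1 ≤ k) : vol2 (hOpening k f₁) = vol2 (hOpening k f₂) := by
  rw [vol2_eq_finsum_vol (finite_support_hOpening hf₁ hk),
    vol2_eq_finsum_vol (finite_support_hOpening hf₂ hk)]
  refine finsum_congr fun i => ?_
  have h₁ := finite_support_row hf₁ i
  have h₂ := finite_support_row hf₂ i
  exact vol_congr (finite_support_opening h₁ hk) (finite_support_opening h₂ hk) fun h hh =>
    ncard_levelSet_opening_congr h₁ h₂ hk hh fun t ht => hrun i t h ht hh

/-- main invariance theorem: if the row-wise run counts
`n_{t,h}^{(i)}` of `f₁` and `f₂` agree for all rows `i`, all `t ≥ 1` and `h ≥ 1`, then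
the granulometric indices w.r.t. horizontal openings agree. -/
theorem gi2_invariant_of_rowRunCount_eq (f₁ f₂ : ℤ × ℤ → ℕ)
    (hf₁ : (Function.support f₁).Finite) (hf₂ : (Function.support f₂).Finite)
    (hpos : 0 < vol2 f₁)
    (hrun : ∀ i : ℤ, ∀ t h : ℕ, 1 ≤ t → 1 ≤ h →
      rowRunCount f₁ i t h = rowRunCount f₂ i t h) :
    gi2 f₁ = gi2 f₂ := by
  have hopen : ∀ k, 1 ≤ k → vol2 (hOpening k f₁) = vol2 (hOpening k f₂) := fun k hk =>
    vol2_hOpening_congr hf₁ hf₂ hrun hk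
  have hone : ∀ f : ℤ × ℤ → ℕ, hOpening 1 f = f := fun f => by
    funext q
    simp only [hOpening, opening_one]
  have hvol : vol2 f₁ = vol2 f₂ := by
    simpa only [hone] using hopen 1 le_rfl
  have hp2 : ∀ k ∈ Set.Ici (1 : ℕ), p2 k f₁ = p2 k f₂ := fun k hk => by
    rw [p2, p2, hopen k hk, hopen (k + 1) (Nat.le_add_left 1 k), hvol]
  unfold gi2
  rw [finsum_mem_congr rfl fun k hk => by rw [hp2 k hk]]

end Granulo
end

section
/- Let f : ℤ² → ℕ be finitely supported with exactly the rows i ∈ {n₁, …, n₂} nonzero, and suppose that for each such row i the row j ↦ f(i,j) is not equal to its reflection j ↦ f(i, m_{2,i} + m_{1,i} − j), where [m_{1,i}, m_{2,i}] is the smallest interval containing the support of row i. Then the family of DEMs obtained by independently either keeping or reflecting each row about its own support interval has cardinality exactly 2^{n₂ − n₁ + 1}, and all of its 2^{n₂ − n₁ + 1} members have the same granulometric index GI with respect to horizontal openings as f. -/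
namespace Granulo

open scoped Classical

/-- The family of DEMs obtained from `f` by independently keeping or reflecting each
row `i ∈ [n₁, n₂]` about its support interval `[m₁ i, m₂ i]`. -/
def reflFamily (f : ℤ × ℤ → ℕ) (n₁ n₂ : ℤ) (m₁ m₂ : ℤ → ℤ) : Set (ℤ × ℤ → ℕ) :=
  {g : ℤ × ℤ → ℕ | ∃ S : Set ℤ, ∀ i j : ℤ,
    g (i, j) = if i ∈ S ∩ Set.Icc n₁ n₂ then f (i, m₂ i + m₁ i - j) else f (i, j)}

theorem opening_reflect (k : ℕ) (f : ℤ → ℕ) (c x : ℤ) :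
    opening k (fun j => f (c - j)) x = opening k f (c - x) := by
  have key : ∀ a : ℤ,
      {n : ℕ | ∃ y : ℤ, a ≤ y ∧ y ≤ a + (k : ℤ) - 1 ∧ n = f (c - y)} =
      {n : ℕ | ∃ y : ℤ, c - a - k + 1 ≤ y ∧ y ≤ c - a - k + 1 + (k : ℤ) - 1 ∧ n = f y} := by
    intro a
    ext n
    constructor
    · rintro ⟨y, h1, h2, rfl⟩
      exact ⟨c - y, by omega, by omega, rfl⟩
    · rintro ⟨y, h1, h2, rfl⟩
      exact ⟨c - y, by omega, by omega, by rw [sub_sub_cancel]⟩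
  unfold opening
  congr 1
  ext m
  constructor
  · rintro ⟨a, h1, h2, rfl⟩
    exact ⟨c - a - k + 1, by omega, by omega, by rw [key]⟩
  · rintro ⟨a, h1, h2, rfl⟩
    refine ⟨c - a - k + 1, by omega, by omega, ?_⟩
    rw [key, show c - (c - a - k + 1) - k + 1 = a by ring]

/-- The permutation of `ℤ²` reflecting `j ↦ c i - j` in each row `i ∈ T`. -/
noncomputable def rowReflection (T : Set ℤ) (c : ℤ → ℤ) : Equiv.Perm (ℤ × ℤ) :=
  Function.Involutive.toPerm (fun q => (q.1, if q.1 ∈ T then c q.1 - q.2 else q.2)) <| by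
    rintro ⟨i, j⟩
    by_cases h : i ∈ T <;> simp [h]

theorem rowReflection_apply (T : Set ℤ) (c : ℤ → ℤ) (i j : ℤ) :
    rowReflection T c (i, j) = (i, if i ∈ T then c i - j else j) := rfl

theorem hOpening_comp_rowReflection (k : ℕ) (f : ℤ × ℤ → ℕ) (T : Set ℤ) (c : ℤ → ℤ) :
    hOpening k (f ∘ rowReflection T c) = hOpening k f ∘ rowReflection T c := by
  ext ⟨i, j⟩
  by_cases h : i ∈ T
  · simpa [hOpening, rowReflection_apply, h] using
      opening_reflect k (fun j => f (i, j)) (c i) j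
  · simp [hOpening, rowReflection_apply, h]

theorem vol2_comp_equiv (f : ℤ × ℤ → ℕ) (e : Equiv.Perm (ℤ × ℤ)) :
    vol2 (f ∘ e) = vol2 f :=
  finsum_comp_equiv e

theorem gi2_comp_rowReflection (f : ℤ × ℤ → ℕ) (T : Set ℤ) (c : ℤ → ℤ) :
    gi2 (f ∘ rowReflection T c) = gi2 f := by
  simp only [gi2, p2, hOpening_comp_rowReflection, vol2_comp_equiv]

theorem reflFamily_eq_image (f : ℤ × ℤ → ℕ) (n₁ n₂ : ℤ) (m₁ m₂ : ℤ → ℤ) :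
    reflFamily f n₁ n₂ m₁ m₂ =
      (fun T => f ∘ rowReflection T fun i => m₂ i + m₁ i) '' 𝒫 (Set.Icc n₁ n₂) := by
  ext g
  constructor
  · rintro ⟨S, hS⟩
    refine ⟨S ∩ Set.Icc n₁ n₂, Set.inter_subset_right, ?_⟩
    ext ⟨i, j⟩
    simp only [hS, Function.comp_apply, rowReflection_apply]
    split_ifs <;> rfl
  · rintro ⟨T, hT, rfl⟩
    refine ⟨T, fun i j => ?_⟩
    simp only [Set.inter_eq_left.mpr hT, Function.comp_apply, rowReflection_apply]
    split_ifs <;> rfl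

theorem injOn_comp_rowReflection {f : ℤ × ℤ → ℕ} {c : ℤ → ℤ} {A : Set ℤ}
    (h : ∀ i ∈ A, ∃ j : ℤ, f (i, j) ≠ f (i, c i - j)) :
    Set.InjOn (fun T => f ∘ rowReflection T c) (𝒫 A) := by
  intro S hS T hT hST
  ext i
  by_cases hi : i ∈ A
  · obtain ⟨j, hj⟩ := h i hi
    have hij := congrFun hST (i, j)
    simp only [Function.comp_apply, rowReflection_apply] at hij
    by_cases h1 : i ∈ S <;> by_cases h2 : i ∈ T <;> simp_all
  · exact iff_of_false (fun h' => hi (hS h')) (fun h' => hi (hT h'))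

/-- if exactly the rows `i ∈ [n₁, n₂]` of `f` are nonzero and no such row
equals its own reflection about its support interval, then the family of DEMs obtained
by independently keeping or reflecting each row has cardinality exactly
`2^(n₂ − n₁ + 1)`, and all of its members have the same granulometric index as `f`. -/
theorem reflFamily_card_and_gi (f : ℤ × ℤ → ℕ) (hf : (Function.support f).Finite)
    (n₁ n₂ : ℤ) (hn : n₁ ≤ n₂)
    (hrows : ∀ i : ℤ, (∃ j : ℤ, f (i, j) ≠ 0) ↔ i ∈ Set.Icc n₁ n₂)
    (m₁ m₂ : ℤ → ℤ)
    (hm : ∀ i ∈ Set.Icc n₁ n₂,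
      (Function.support fun j : ℤ => f (i, j)) ⊆ Set.Icc (m₁ i) (m₂ i) ∧
      f (i, m₁ i) ≠ 0 ∧ f (i, m₂ i) ≠ 0)
    (hasym : ∀ i ∈ Set.Icc n₁ n₂, ∃ j : ℤ, f (i, j) ≠ f (i, m₂ i + m₁ i - j)) :
    (reflFamily f n₁ n₂ m₁ m₂).ncard = 2 ^ (n₂ - n₁ + 1).toNat ∧
    ∀ g ∈ reflFamily f n₁ n₂ m₁ m₂, gi2 g = gi2 f := by
  rw [reflFamily_eq_image]
  refine ⟨?_, ?_⟩
  · rw [(injOn_comp_rowReflection hasym).ncard_image,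
      Set.ncard_powerset _ (Set.finite_Icc n₁ n₂), ← Finset.coe_Icc, Set.ncard_coe_finset,
      Int.card_Icc, show n₂ + 1 - n₁ = n₂ - n₁ + 1 by ring]
  · rintro _ ⟨T, -, rfl⟩
    exact gi2_comp_rowReflection f T _

end Granulo
end
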